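/- arXiv:2105.03368 — 4 statements merged into one kernel-verified Lean document; each statement's English description precedes it below -/
import Mathlib

section
/- The function t ↦ G(t) − (1/(2m))·g(t)·t is even on ℝ and is increasing for t > 0. -/
open MeasureTheory Filter Topology

noncomputable section

theorem stmt_6
    (N : ℕ) (hN : 3 ≤ N)
    (g : ℝ → ℝ)
    (hg_odd : ∀ t, g (-t) = - g t)
    (hg_mono : Monotone g)
    (hg_smooth : ContDiff ℝ 1 g)
    (hg_zero : g 0 = 0)
    (hg_pos : ∀ t > (0:ℝ), 0 < g t)
    (hg_top : Tendsto g atTop atTop)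
    (G : ℝ → ℝ)
    (hG : ∀ t, G t = ∫ s in (0:ℝ)..t, g s)
    (L m : ℝ)
    (hL : (N:ℝ)/2 < L ∧ L < (N:ℝ))
    (hm : L < m ∧ m < min (L * (N:ℝ) / ((N:ℝ) - L) / 2) (N:ℝ))
    (hg2 : ∀ t > (0:ℝ), L ≤ t * g t / G t ∧ t * g t / G t ≤ m)
    (hg3 : ∀ t > (0:ℝ), L - 1 ≤ t * deriv g t / g t ∧ t * deriv g t / g t ≤ m - 1)
    :
    (∀ t : ℝ, G (-t) - 1/(2*m) * g (-t) * (-t) = G t - 1/(2*m) * g t * t) ∧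
      StrictMonoOn (fun t => G t - 1/(2*m) * g t * t) (Set.Ioi (0:ℝ)) := by
  have hg_cont : Continuous g := hg_smooth.continuous
  have hN_pos : (0:ℝ) < N := by
    have : 0 < N := by omega
    exact_mod_cast this
  have hm_pos : 0 < m := by linarith [hL.1, hm.1]
  have hG_even : ∀ t, G (-t) = G t := by
    intro t
    have h := intervalIntegral.integral_comp_neg (a := 0) (b := t) g
    simp only [hg_odd, intervalIntegral.integral_neg, neg_zero] at h
    rw [hG, hG, intervalIntegral.integral_symm, ← h, neg_neg]
  have hG_deriv : ∀ t, HasDerivAt G (g t) t := by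
    intro t
    rw [funext hG]
    exact hg_cont.integral_hasStrictDerivAt 0 t |>.hasDerivAt
  have hg_deriv : ∀ t, HasDerivAt g (deriv g t) t := fun t =>
    (hg_smooth.differentiable one_ne_zero t).hasDerivAt
  have h_deriv : ∀ t, HasDerivAt (fun t => G t - 1/(2*m) * g t * t)
      (g t - (1/(2*m) * deriv g t * t + 1/(2*m) * g t * 1)) t := fun t =>
    (hG_deriv t).sub (((hg_deriv t).const_mul _).mul (hasDerivAt_id t))
  refine ⟨fun t => by rw [hG_even, hg_odd]; ring, ?_⟩
  refine strictMonoOn_of_deriv_pos (convex_Ioi 0)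
    (fun t _ => (h_deriv t).continuousAt.continuousWithinAt) fun t ht => ?_
  rw [interior_Ioi] at ht
  have hgt := hg_pos t ht
  have h_upper : t * deriv g t ≤ (m - 1) * g t := (div_le_iff₀ hgt).1 (hg3 t ht).2
  have h_half : 1/(2*m) * (t * deriv g t + g t) ≤ g t / 2 := by
    calc 1/(2*m) * (t * deriv g t + g t) ≤ 1/(2*m) * (m * g t) := by
          gcongr
          linarith
      _ = g t / 2 := by field_simp
  rw [(h_deriv t).deriv]
  linarith
end
end

section
/- The function t ↦ (1/(2m))·f(t)·t − F(t) is increasing on (0, +∞) and decreasing on (−∞, 0). -/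
open MeasureTheory Filter Topology

noncomputable section

/-- If `f t / t ^ (p - 1)` is strictly increasing on the positive half-line, then so is
`f t * t / p - ∫ s in 0..t, f s`. -/
theorem strictMonoOn_mul_sub_integral_of_div_rpow {p : ℝ} (hp : 0 < p) {f : ℝ → ℝ}
    (hf : Continuous f) (hmono : StrictMonoOn (fun t => f t / t ^ (p - 1)) (Set.Ioi 0)) :
    StrictMonoOn (fun t => 1 / p * f t * t - ∫ s in (0 : ℝ)..t, f s) (Set.Ioi 0) := by
  intro a ha b hb hab
  have ha' : 0 < a := ha
  have hb' : 0 < b := hb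
  have hlt : f a / a ^ (p - 1) < f b / b ^ (p - 1) := hmono ha hb hab
  have hfac : ∀ t, 0 < t → f t * t = f t / t ^ (p - 1) * t ^ p := by
    intro t ht
    have hpos : 0 < t ^ (p - 1) := Real.rpow_pos_of_pos ht _
    have hsplit : t ^ p = t ^ (p - 1) * t := by
      rw [← Real.rpow_add_one ht.ne', sub_add_cancel]
    rw [hsplit]
    field_simp
  have hsub : (∫ s in (0 : ℝ)..b, f s) - ∫ s in (0 : ℝ)..a, f s = ∫ s in a..b, f s :=
    intervalIntegral.integral_interval_sub_left (hf.intervalIntegrable _ _)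
      (hf.intervalIntegrable _ _)
  have hle : ∫ s in a..b, f s ≤ f b / b ^ (p - 1) * ((b ^ p - a ^ p) / p) := by
    have hint : ∫ s in a..b, s ^ (p - 1) = (b ^ p - a ^ p) / p := by
      rw [integral_rpow (Or.inl (by linarith)), sub_add_cancel]
    rw [← hint, ← intervalIntegral.integral_const_mul]
    refine intervalIntegral.integral_mono_on hab.le (hf.intervalIntegrable _ _)
      ((intervalIntegral.intervalIntegrable_rpow' (by linarith)).const_mul _) fun s hs => ?_
    have hs' : 0 < s := ha'.trans_le hs.1
    rw [← div_le_iff₀ (Real.rpow_pos_of_pos hs' _)]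
    exact hmono.monotoneOn hs' hb hs.2
  have hgap : 0 < (f b / b ^ (p - 1) - f a / a ^ (p - 1)) * a ^ p / p :=
    div_pos (mul_pos (sub_pos.2 hlt) (Real.rpow_pos_of_pos ha' _)) hp
  have hdiff : 1 / p * f b * b - 1 / p * f a * a
      = f b / b ^ (p - 1) * ((b ^ p - a ^ p) / p)
        + (f b / b ^ (p - 1) - f a / a ^ (p - 1)) * a ^ p / p := by
    rw [mul_assoc, mul_assoc, hfac a ha', hfac b hb']
    ring
  change 1 / p * f a * a - _ < 1 / p * f b * b - _
  linarith

theorem stmt_7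
    (m : ℝ) (hm : 1 < m)
    (f F : ℝ → ℝ)
    (hf_smooth : ContDiff ℝ 1 f)
    (hF : ∀ t, F t = ∫ s in (0:ℝ)..t, f s)
    (hf4 : StrictMonoOn (fun t => f t / |t| ^ (2 * m - 1)) {t : ℝ | t ≠ 0})
    :
    StrictMonoOn (fun t => 1/(2*m) * f t * t - F t) (Set.Ioi (0:ℝ)) ∧
      StrictAntiOn (fun t => 1/(2*m) * f t * t - F t) (Set.Iio (0:ℝ)) := by
  have hp : 0 < 2 * m := by linarith
  have hf := hf_smooth.continuous
  simp only [hF]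
  constructor
  · refine strictMonoOn_mul_sub_integral_of_div_rpow hp hf fun a ha b hb hab => ?_
    have h := hf4 (ne_of_gt ha) (ne_of_gt hb) hab
    simpa only [abs_of_pos (Set.mem_Ioi.1 ha), abs_of_pos (Set.mem_Ioi.1 hb)] using h
  · have hodd : StrictMonoOn (fun t => -f (-t) / t ^ (2 * m - 1)) (Set.Ioi 0) := by
      intro a ha b hb hab
      have h := hf4 (neg_ne_zero.2 (ne_of_gt hb)) (neg_ne_zero.2 (ne_of_gt ha)) (neg_lt_neg hab)
      simp only [abs_neg, abs_of_pos (Set.mem_Ioi.1 ha), abs_of_pos (Set.mem_Ioi.1 hb)] at h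
      simpa only [neg_div] using neg_lt_neg h
    have key := strictMonoOn_mul_sub_integral_of_div_rpow hp
      (f := fun t => -f (-t)) (by fun_prop) hodd
    intro a ha b hb hab
    have h := key (Set.mem_Ioi.2 (neg_pos.2 hb)) (Set.mem_Ioi.2 (neg_pos.2 ha)) (neg_lt_neg hab)
    have hint : ∀ t, ∫ s in (0 : ℝ)..-t, -f (-s) = ∫ s in (0 : ℝ)..t, f s := by
      intro t
      rw [intervalIntegral.integral_neg, intervalIntegral.integral_comp_neg, neg_neg, neg_zero,
        intervalIntegral.integral_symm, neg_neg]
    simpa only [hint, neg_neg, mul_neg, neg_mul] using h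
end
end

section
/- For every w ∈ W^{α,G}(ℝ^N) and all t, s ≥ 0, the quantities Q_{t,s}, E_{t,s} and H_{t,s} are nonnegative: Q_{t,s} ≥ 0, E_{t,s} ≥ 0 and H_{t,s} ≥ 0. -/
open MeasureTheory Filter Topology

noncomputable section

abbrev Euc (N : ℕ) := EuclideanSpace ℝ (Fin N)

noncomputable def rhoG {N : ℕ} (G : ℝ → ℝ) (u : Euc N → ℝ) : ℝ := ∫ x, G (u x)

noncomputable def rhoBar {N : ℕ} (α : ℝ) (G : ℝ → ℝ) (u : Euc N → ℝ) : ℝ :=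
  ∫ p : Euc N × Euc N, G ((u p.1 - u p.2) / dist p.1 p.2 ^ α) / dist p.1 p.2 ^ (N : ℝ)

noncomputable def rhoT {N : ℕ} (α : ℝ) (G : ℝ → ℝ) (u : Euc N → ℝ) : ℝ :=
  rhoG G u + rhoBar α G u

def memW {N : ℕ} (α : ℝ) (G : ℝ → ℝ) (u : Euc N → ℝ) : Prop :=
  Measurable u ∧ Integrable (fun x => G (u x)) ∧
    Integrable (fun p : Euc N × Euc N =>
      G ((u p.1 - u p.2) / dist p.1 p.2 ^ α) / dist p.1 p.2 ^ (N : ℝ))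

noncomputable def pPart {N : ℕ} (w : Euc N → ℝ) : Euc N → ℝ := fun x => max (w x) 0

noncomputable def nPart {N : ℕ} (w : Euc N → ℝ) : Euc N → ℝ := fun x => min (w x) 0

def Aset {N : ℕ} (w : Euc N → ℝ) : Set (Euc N) := {x | 0 ≤ w x}

def Bset {N : ℕ} (w : Euc N → ℝ) : Set (Euc N) := {x | w x < 0}

noncomputable def Ets {N : ℕ} (α : ℝ) (g : ℝ → ℝ) (w : Euc N → ℝ) (t s : ℝ) : ℝ :=
  (∫ p in Aset w ×ˢ Bset w,
      (g ((t * pPart w p.1 - s * nPart w p.2) / dist p.1 p.2 ^ α)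
        - g (t * pPart w p.1 / dist p.1 p.2 ^ α))
      * (t * pPart w p.1) / dist p.1 p.2 ^ (α + (N : ℝ)))
  + ∫ p in Bset w ×ˢ Aset w,
      (g ((s * nPart w p.1 - t * pPart w p.2) / dist p.1 p.2 ^ α)
        - g (-(t * pPart w p.2) / dist p.1 p.2 ^ α))
      * (-(t * pPart w p.2)) / dist p.1 p.2 ^ (α + (N : ℝ))

noncomputable def Hts {N : ℕ} (α : ℝ) (g : ℝ → ℝ) (w : Euc N → ℝ) (t s : ℝ) : ℝ :=
  (∫ p in Aset w ×ˢ Bset w,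
      (g ((t * pPart w p.1 - s * nPart w p.2) / dist p.1 p.2 ^ α)
        - g (-(s * nPart w p.2) / dist p.1 p.2 ^ α))
      * (-(s * nPart w p.2)) / dist p.1 p.2 ^ (α + (N : ℝ)))
  + ∫ p in Bset w ×ˢ Aset w,
      (g ((s * nPart w p.1 - t * pPart w p.2) / dist p.1 p.2 ^ α)
        - g (s * nPart w p.1 / dist p.1 p.2 ^ α))
      * (s * nPart w p.1) / dist p.1 p.2 ^ (α + (N : ℝ))

noncomputable def Qts {N : ℕ} (α : ℝ) (G : ℝ → ℝ) (w : Euc N → ℝ) (t s : ℝ) : ℝ :=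
  (∫ p in Aset w ×ˢ Bset w,
      (G ((t * pPart w p.1 - s * nPart w p.2) / dist p.1 p.2 ^ α)
        - G (t * pPart w p.1 / dist p.1 p.2 ^ α)
        - G (-(s * nPart w p.2) / dist p.1 p.2 ^ α)) / dist p.1 p.2 ^ (N : ℝ))
  + ∫ p in Bset w ×ˢ Aset w,
      (G ((s * nPart w p.1 - t * pPart w p.2) / dist p.1 p.2 ^ α)
        - G (s * nPart w p.1 / dist p.1 p.2 ^ α)
        - G (-(t * pPart w p.2) / dist p.1 p.2 ^ α)) / dist p.1 p.2 ^ (N : ℝ)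

theorem pPart_nonneg {N : ℕ} (w : Euc N → ℝ) (x : Euc N) : 0 ≤ pPart w x := le_max_right _ _

theorem nPart_nonpos {N : ℕ} (w : Euc N → ℝ) (x : Euc N) : nPart w x ≤ 0 := min_le_right _ _

/-- The primitive of an odd function is even. -/
theorem integral_neg_right_of_odd {g : ℝ → ℝ} (hg : ∀ t, g (-t) = -g t) (x : ℝ) :
    ∫ s in (0 : ℝ)..(-x), g s = ∫ s in (0 : ℝ)..x, g s := by
  have h := intervalIntegral.integral_comp_neg (a := 0) (b := x) g
  simp only [hg, intervalIntegral.integral_neg, neg_zero] at h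
  rw [intervalIntegral.integral_symm, ← h, neg_neg]

/-- The primitive of a monotone function is superadditive on the nonnegative reals. -/
theorem integral_add_integral_le_of_monotone {g : ℝ → ℝ} (hg : Monotone g) {a b : ℝ}
    (ha : 0 ≤ a) (hb : 0 ≤ b) :
    (∫ s in (0 : ℝ)..a, g s) + ∫ s in (0 : ℝ)..b, g s ≤ ∫ s in (0 : ℝ)..(a + b), g s := by
  have hi : ∀ c d : ℝ, IntervalIntegrable g volume c d := fun c d => hg.intervalIntegrable
  rw [← intervalIntegral.integral_add_adjacent_intervals (hi 0 a) (hi a (a + b))]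
  have hshift : ∫ s in a..(a + b), g s = ∫ s in (0 : ℝ)..b, g (s + a) := by
    rw [intervalIntegral.integral_comp_add_right, zero_add, add_comm b a]
  have hmono : Monotone fun s => g (s + a) := fun x y hxy => hg (by linarith)
  rw [hshift]
  gcongr
  exact intervalIntegral.integral_mono_on hb (hi 0 b) hmono.intervalIntegrable
    fun x _ => hg (by linarith)

theorem stmt_9
    (N : ℕ) (hN : 3 ≤ N)
    (α : ℝ) (hα : 0 < α ∧ α < 1)
    (g : ℝ → ℝ)
    (hg_odd : ∀ t, g (-t) = - g t)
    (hg_mono : Monotone g)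
    (hg_smooth : ContDiff ℝ 1 g)
    (hg_zero : g 0 = 0)
    (hg_pos : ∀ t > (0:ℝ), 0 < g t)
    (hg_top : Tendsto g atTop atTop)
    (G : ℝ → ℝ)
    (hG : ∀ t, G t = ∫ s in (0:ℝ)..t, g s)
    :
    ∀ w : Euc N → ℝ, memW α G w → ∀ t s : ℝ, 0 ≤ t → 0 ≤ s →
      0 ≤ Qts α G w t s ∧ 0 ≤ Ets α g w t s ∧ 0 ≤ Hts α g w t s := by
  intro w _ t s ht hs
  have hp : ∀ x, 0 ≤ t * pPart w x := fun x => mul_nonneg ht (pPart_nonneg w x)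
  have hn : ∀ x, s * nPart w x ≤ 0 := fun x => mul_nonpos_of_nonneg_of_nonpos hs (nPart_nonpos w x)
  have hd : ∀ (p : Euc N × Euc N) (r : ℝ), 0 ≤ dist p.1 p.2 ^ r :=
    fun p r => Real.rpow_nonneg dist_nonneg r
  have hG_neg : ∀ x, G (-x) = G x := fun x => by
    rw [hG, hG, integral_neg_right_of_odd hg_odd]
  have hG_add : ∀ a b c : ℝ, 0 ≤ a → 0 ≤ b → 0 ≤ c → G (a / c) + G (b / c) ≤ G ((a + b) / c) :=
    fun a b c ha hb hc => by
      rw [hG, hG, hG, add_div]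
      exact integral_add_integral_le_of_monotone hg_mono (div_nonneg ha hc) (div_nonneg hb hc)
  have hg_div : ∀ a b c : ℝ, 0 ≤ c → a ≤ b → g (a / c) ≤ g (b / c) :=
    fun a b c hc hab => hg_mono (div_le_div_of_nonneg_right hab hc)
  refine ⟨add_nonneg (integral_nonneg fun p => div_nonneg ?_ (hd p _))
      (integral_nonneg fun p => div_nonneg ?_ (hd p _)),
    add_nonneg (integral_nonneg fun p => div_nonneg (mul_nonneg ?_ (hp _)) (hd p _))
      (integral_nonneg fun p =>
        div_nonneg (mul_nonneg_of_nonpos_of_nonpos ?_ (neg_nonpos.2 (hp _))) (hd p _)),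
    add_nonneg
      (integral_nonneg fun p => div_nonneg (mul_nonneg ?_ (neg_nonneg.2 (hn _))) (hd p _))
      (integral_nonneg fun p =>
        div_nonneg (mul_nonneg_of_nonpos_of_nonpos ?_ (hn _)) (hd p _))⟩
  · have h := hG_add _ _ _ (hp p.1) (neg_nonneg.2 (hn p.2)) (hd p α)
    rw [← sub_eq_add_neg] at h
    linarith
  · have h := hG_add _ _ _ (neg_nonneg.2 (hn p.1)) (hp p.2) (hd p α)
    rw [← hG_neg ((_ + _) / _), ← neg_div, neg_add, neg_neg, ← sub_eq_add_neg, neg_div, hG_neg,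
      ← hG_neg (t * pPart w p.2 / _), ← neg_div] at h
    linarith
  · exact sub_nonneg.2 (hg_div _ _ _ (hd p α) (by linarith [hn p.2]))
  · exact sub_nonpos.2 (hg_div _ _ _ (hd p α) (by linarith [hn p.1]))
  · exact sub_nonneg.2 (hg_div _ _ _ (hd p α) (by linarith [hp p.1]))
  · exact sub_nonpos.2 (hg_div _ _ _ (hd p α) (by linarith [hp p.2]))
end
end

section
/- For every u ∈ 𝒩 one has J(u) ≥ (1 − m/θ)·min{‖u‖^L, ‖u‖^m}; in particular, J restricted to 𝒩 is coercive: J(u) → +∞ as ‖u‖ → +∞ with u ∈ 𝒩. -/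
open MeasureTheory Filter Topology

noncomputable section

noncomputable def wNorm {N : ℕ} (α : ℝ) (G : ℝ → ℝ) (u : Euc N → ℝ) : ℝ :=
  sInf {l : ℝ | 0 < l ∧ rhoT α G (fun x => u x / l) ≤ 1}

noncomputable def Jpair {N : ℕ} (α : ℝ) (g f : ℝ → ℝ) (K : Euc N → ℝ) (u v : Euc N → ℝ) : ℝ :=
  (∫ p : Euc N × Euc N,
      g ((u p.1 - u p.2) / dist p.1 p.2 ^ α) * (v p.1 - v p.2) / dist p.1 p.2 ^ (α + (N : ℝ)))
  + (∫ x, g (u x) * v x) - ∫ x, K x * f (u x) * v x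

noncomputable def Jfun {N : ℕ} (α : ℝ) (G F : ℝ → ℝ) (K : Euc N → ℝ) (u : Euc N → ℝ) : ℝ :=
  rhoT α G u - ∫ x, K x * F (u x)

def Nehari {N : ℕ} (α : ℝ) (G g f : ℝ → ℝ) (K : Euc N → ℝ) : Set (Euc N → ℝ) :=
  {u | memW α G u ∧ ¬ (u =ᵐ[volume] (fun _ => (0:ℝ))) ∧ Jpair α g f K u u = 0}

section NFunction

variable {g G : ℝ → ℝ} {L m : ℝ}

theorem hasDerivAt_primitive (hg : Continuous g) (hG : ∀ t, G t = ∫ s in (0:ℝ)..t, g s) (t : ℝ) :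
    HasDerivAt G (g t) t := by
  have hG' : G = fun t => ∫ s in (0:ℝ)..t, g s := funext hG
  rw [hG']
  exact intervalIntegral.integral_hasDerivAt_right (hg.intervalIntegrable _ _)
    (hg.stronglyMeasurableAtFilter _ _) hg.continuousAt

theorem primitive_zero (hG : ∀ t, G t = ∫ s in (0:ℝ)..t, g s) : G 0 = 0 := by
  rw [hG, intervalIntegral.integral_same]

theorem primitive_even (hodd : ∀ t, g (-t) = - g t) (hG : ∀ t, G t = ∫ s in (0:ℝ)..t, g s)
    (t : ℝ) : G (-t) = G t := by
  have h := intervalIntegral.integral_comp_neg (a := 0) (b := t) g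
  simp only [hodd, intervalIntegral.integral_neg, neg_zero] at h
  rw [hG, hG, intervalIntegral.integral_symm, ← h, neg_neg]

theorem primitive_abs (hodd : ∀ t, g (-t) = - g t) (hG : ∀ t, G t = ∫ s in (0:ℝ)..t, g s)
    (t : ℝ) : G |t| = G t := by
  rcases abs_choice t with h | h <;> rw [h]
  exact primitive_even hodd hG t

theorem primitive_pos (hg : Continuous g) (hpos : ∀ t > (0:ℝ), 0 < g t)
    (hG : ∀ t, G t = ∫ s in (0:ℝ)..t, g s) {t : ℝ} (ht : 0 < t) : 0 < G t := by
  rw [hG]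
  exact intervalIntegral.intervalIntegral_pos_of_pos_on (hg.intervalIntegrable _ _)
    (fun x hx => hpos x hx.1) ht

theorem primitive_nonneg (hg : Continuous g) (hodd : ∀ t, g (-t) = - g t)
    (hpos : ∀ t > (0:ℝ), 0 < g t) (hG : ∀ t, G t = ∫ s in (0:ℝ)..t, g s) (t : ℝ) : 0 ≤ G t := by
  rw [← primitive_abs hodd hG]
  rcases (abs_nonneg t).eq_or_lt with h | h
  · rw [← h, primitive_zero hG]
  · exact (primitive_pos hg hpos hG h).le

theorem odd_mul_self_nonneg (hodd : ∀ t, g (-t) = - g t) (hpos : ∀ t > (0:ℝ), 0 < g t) (t : ℝ) :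
    0 ≤ g t * t := by
  rcases lt_trichotomy t 0 with h | h | h
  · have := hpos (-t) (by linarith)
    rw [hodd] at this
    nlinarith
  · simp [h]
  · exact (mul_pos (hpos t h) h).le

theorem odd_mul_self_le (hg : Continuous g) (hodd : ∀ t, g (-t) = - g t)
    (hpos : ∀ t > (0:ℝ), 0 < g t) (hG : ∀ t, G t = ∫ s in (0:ℝ)..t, g s)
    (hm : ∀ t > (0:ℝ), t * g t / G t ≤ m) (t : ℝ) : g t * t ≤ m * G t := by
  have key : ∀ t > 0, g t * t ≤ m * G t := fun t ht => by
    have := (div_le_iff₀ (primitive_pos hg hpos hG ht)).1 (hm t ht)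
    linarith
  rcases lt_trichotomy t 0 with h | h | h
  · have := key (-t) (by linarith)
    rw [hodd, primitive_even hodd hG] at this
    linarith
  · simp [h, primitive_zero hG]
  · exact key t h

theorem monotoneOn_primitive_mul_rpow (hg : Continuous g) (hpos : ∀ t > (0:ℝ), 0 < g t)
    (hG : ∀ t, G t = ∫ s in (0:ℝ)..t, g s) (hL : ∀ t > (0:ℝ), L ≤ t * g t / G t) :
    MonotoneOn (fun t => G t * t ^ (-L)) (Set.Ioi 0) := by
  have hd : ∀ t > (0:ℝ), HasDerivAt (fun t => G t * t ^ (-L))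
      (g t * t ^ (-L) + G t * ((-L) * t ^ (-L - 1))) t := fun t ht =>
    (hasDerivAt_primitive hg hG t).mul (Real.hasDerivAt_rpow_const (Or.inl ht.ne'))
  refine monotoneOn_of_deriv_nonneg (convex_Ioi 0)
    (fun t ht => (hd t ht).continuousAt.continuousWithinAt)
    (fun t ht => (hd t (interior_subset ht)).differentiableAt.differentiableWithinAt) ?_
  intro t ht
  have ht : 0 < t := interior_subset ht
  rw [(hd t ht).deriv]
  have h1 := (le_div_iff₀ (primitive_pos hg hpos hG ht)).1 (hL t ht)
  have h2 : t ^ (-L) = t * t ^ (-L - 1) := by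
    rw [Real.rpow_sub_one ht.ne']; field_simp
  rw [h2]
  have := mul_nonneg (sub_nonneg.2 h1) (Real.rpow_nonneg ht.le (-L - 1))
  linarith

theorem antitoneOn_primitive_mul_rpow (hg : Continuous g) (hpos : ∀ t > (0:ℝ), 0 < g t)
    (hG : ∀ t, G t = ∫ s in (0:ℝ)..t, g s) (hm : ∀ t > (0:ℝ), t * g t / G t ≤ m) :
    AntitoneOn (fun t => G t * t ^ (-m)) (Set.Ioi 0) := by
  have hd : ∀ t > (0:ℝ), HasDerivAt (fun t => G t * t ^ (-m))
      (g t * t ^ (-m) + G t * ((-m) * t ^ (-m - 1))) t := fun t ht =>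
    (hasDerivAt_primitive hg hG t).mul (Real.hasDerivAt_rpow_const (Or.inl ht.ne'))
  refine antitoneOn_of_deriv_nonpos (convex_Ioi 0)
    (fun t ht => (hd t ht).continuousAt.continuousWithinAt)
    (fun t ht => (hd t (interior_subset ht)).differentiableAt.differentiableWithinAt) ?_
  intro t ht
  have ht : 0 < t := interior_subset ht
  rw [(hd t ht).deriv]
  have h1 := (div_le_iff₀ (primitive_pos hg hpos hG ht)).1 (hm t ht)
  have h2 : t ^ (-m) = t * t ^ (-m - 1) := by
    rw [Real.rpow_sub_one ht.ne']; field_simp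
  rw [h2]
  have := mul_nonneg (sub_nonneg.2 h1) (Real.rpow_nonneg ht.le (-m - 1))
  linarith

theorem min_rpow_mul_primitive_div_le (hg : Continuous g) (hodd : ∀ t, g (-t) = - g t)
    (hpos : ∀ t > (0:ℝ), 0 < g t) (hG : ∀ t, G t = ∫ s in (0:ℝ)..t, g s)
    (hLm : ∀ t > (0:ℝ), L ≤ t * g t / G t ∧ t * g t / G t ≤ m) {l : ℝ} (hl : 0 < l) (t : ℝ) :
    min (l ^ L) (l ^ m) * G (t / l) ≤ G t := by
  rw [← primitive_abs hodd hG t, ← primitive_abs hodd hG (t / l), abs_div, abs_of_pos hl]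
  rcases (abs_nonneg t).eq_or_lt with h | h
  · simp [← h, primitive_zero hG]
  set s := |t|
  have hsl : 0 < s / l := div_pos h hl
  have hGn : 0 ≤ G (s / l) := (primitive_pos hg hpos hG hsl).le
  have conv : ∀ p : ℝ, G (s / l) * (s / l) ^ (-p) ≤ G s * s ^ (-p) →
      l ^ p * G (s / l) ≤ G s := fun p hp => by
    have hsp : 0 < s ^ (-p) := Real.rpow_pos_of_pos h _
    rw [Real.div_rpow h.le hl.le, Real.rpow_neg hl.le, div_inv_eq_mul] at hp
    refine le_of_mul_le_mul_right ?_ hsp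
    linarith
  rcases le_total 1 l with h1 | h1
  · refine (mul_le_mul_of_nonneg_right (min_le_left _ _) hGn).trans (conv L ?_)
    exact monotoneOn_primitive_mul_rpow hg hpos hG (fun t ht => (hLm t ht).1) hsl h
      (div_le_self h.le h1)
  · refine (mul_le_mul_of_nonneg_right (min_le_right _ _) hGn).trans (conv m ?_)
    exact antitoneOn_primitive_mul_rpow hg hpos hG (fun t ht => (hLm t ht).2) h hsl
      (le_div_self h.le hl h1)

end NFunction

section Modular

variable {N : ℕ} {α : ℝ} {g G : ℝ → ℝ} {L m : ℝ}

theorem rhoT_nonneg (hG : ∀ t, 0 ≤ G t) (u : Euc N → ℝ) : 0 ≤ rhoT α G u :=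
  add_nonneg (integral_nonneg fun _ => hG _)
    (integral_nonneg fun _ => div_nonneg (hG _) (Real.rpow_nonneg dist_nonneg _))

theorem min_rpow_mul_rhoT_div_le (hg : Continuous g) (hodd : ∀ t, g (-t) = - g t)
    (hpos : ∀ t > (0:ℝ), 0 < g t) (hG : ∀ t, G t = ∫ s in (0:ℝ)..t, g s)
    (hLm : ∀ t > (0:ℝ), L ≤ t * g t / G t ∧ t * g t / G t ≤ m) {l : ℝ} (hl : 0 < l)
    {u : Euc N → ℝ} (hu : memW α G u) :
    min (l ^ L) (l ^ m) * rhoT α G (fun x => u x / l) ≤ rhoT α G u := by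
  have hGn := primitive_nonneg hg hodd hpos hG
  have hc : 0 ≤ min (l ^ L) (l ^ m) := by positivity
  have key := min_rpow_mul_primitive_div_le hg hodd hpos hG hLm hl
  unfold rhoT rhoG rhoBar
  rw [mul_add, ← integral_const_mul, ← integral_const_mul]
  refine add_le_add
    (integral_mono_of_nonneg (.of_forall fun x => mul_nonneg hc (hGn _)) hu.2.1
      (.of_forall fun x => key _))
    (integral_mono_of_nonneg (.of_forall fun p => ?_) hu.2.2 (.of_forall fun p => ?_))
  · exact mul_nonneg hc (div_nonneg (hGn _) (Real.rpow_nonneg dist_nonneg _))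
  · dsimp only
    rw [← mul_div_assoc, ← sub_div, div_right_comm]
    exact div_le_div_of_nonneg_right (key _) (Real.rpow_nonneg dist_nonneg _)

theorem wNorm_nonneg (u : Euc N → ℝ) : 0 ≤ wNorm α G u :=
  Real.sInf_nonneg fun _ hl => hl.1.le

theorem min_rpow_wNorm_le_rhoT (hg : Continuous g) (hodd : ∀ t, g (-t) = - g t)
    (hpos : ∀ t > (0:ℝ), 0 < g t) (hG : ∀ t, G t = ∫ s in (0:ℝ)..t, g s)
    (hLm : ∀ t > (0:ℝ), L ≤ t * g t / G t ∧ t * g t / G t ≤ m) (hL : 0 < L) (hm : 0 < m)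
    {u : Euc N → ℝ} (hu : memW α G u) :
    min (wNorm α G u ^ L) (wNorm α G u ^ m) ≤ rhoT α G u := by
  have hr := rhoT_nonneg (α := α) (primitive_nonneg hg hodd hpos hG) u
  rcases (wNorm_nonneg (α := α) (G := G) u).eq_or_lt with h0 | h0
  · rwa [← h0, Real.zero_rpow hL.ne', Real.zero_rpow hm.ne', min_self]
  have hlt : ∀ l ∈ Set.Ioo 0 (wNorm α G u), min (l ^ L) (l ^ m) ≤ rhoT α G u := by
    intro l hl
    have h1 : 1 < rhoT α G (fun x => u x / l) := by
      by_contra! hle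
      exact absurd hl.2 (not_lt.2 (csInf_le ⟨0, fun _ h => h.1.le⟩ ⟨hl.1, hle⟩))
    have hl0 : 0 < l := hl.1
    have hc : 0 ≤ min (l ^ L) (l ^ m) := by positivity
    exact (le_mul_of_one_le_right hc h1.le).trans
      (min_rpow_mul_rhoT_div_le hg hodd hpos hG hLm hl0 hu)
  have hcont : Continuous fun l : ℝ => min (l ^ L) (l ^ m) :=
    (Real.continuous_rpow_const hL.le).min (Real.continuous_rpow_const hm.le)
  exact le_of_tendsto (hcont.continuousAt.tendsto.mono_left nhdsWithin_le_nhds)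
    (Filter.mem_of_superset (Ioo_mem_nhdsLT h0) hlt)

end Modular

section Nehari

variable {N : ℕ} {α : ℝ} {g G f F : ℝ → ℝ} {L m θ : ℝ} {K : Euc N → ℝ}

theorem mul_sub_div_dist_rpow (hα : 0 < α) (u : Euc N → ℝ) (p : Euc N × Euc N) :
    g ((u p.1 - u p.2) / dist p.1 p.2 ^ α) * (u p.1 - u p.2) / dist p.1 p.2 ^ (α + (N : ℝ)) =
      g ((u p.1 - u p.2) / dist p.1 p.2 ^ α) * ((u p.1 - u p.2) / dist p.1 p.2 ^ α) /
        dist p.1 p.2 ^ (N : ℝ) := by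
  rw [Real.rpow_add_of_nonneg dist_nonneg hα.le N.cast_nonneg, mul_div_assoc, mul_div_assoc,
    div_div]

theorem mul_rhoT_le_Jfun (hα : 0 < α) (hg : Continuous g) (hodd : ∀ t, g (-t) = - g t)
    (hpos : ∀ t > (0:ℝ), 0 < g t) (hG : ∀ t, G t = ∫ s in (0:ℝ)..t, g s)
    (hm : ∀ t > (0:ℝ), t * g t / G t ≤ m)
    (hF : ∀ t, F t = ∫ s in (0:ℝ)..t, f s) (hθ : 0 < θ)
    (hf3 : ∀ t : ℝ, t ≠ 0 → 0 < θ * F t ∧ θ * F t ≤ t * f t) (hK : ∀ x, 0 < K x)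
    {u : Euc N → ℝ} (hu : u ∈ Nehari α G g f K) :
    (1 - m / θ) * rhoT α G u ≤ Jfun α G F K u := by
  obtain ⟨⟨hum, hi1, hi2⟩, hne, hJ⟩ := hu
  have hgt := odd_mul_self_nonneg hodd hpos
  have hgG := odd_mul_self_le hg hodd hpos hG hm
  have hdN : ∀ p : Euc N × Euc N, 0 ≤ dist p.1 p.2 ^ (N : ℝ) :=
    fun p => Real.rpow_nonneg dist_nonneg _
  have hB : ∫ x, g (u x) * u x ≤ m * rhoG G u := by
    rw [rhoG, ← integral_const_mul]
    exact integral_mono_of_nonneg (.of_forall fun x => hgt _) (hi1.const_mul m)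
      (.of_forall fun x => hgG _)
  unfold Jpair at hJ
  simp only [mul_sub_div_dist_rpow hα] at hJ
  have hA : ∫ p : Euc N × Euc N, g ((u p.1 - u p.2) / dist p.1 p.2 ^ α) *
      ((u p.1 - u p.2) / dist p.1 p.2 ^ α) / dist p.1 p.2 ^ (N : ℝ) ≤ m * rhoBar α G u := by
    rw [rhoBar, ← integral_const_mul]
    refine integral_mono_of_nonneg (.of_forall fun p => div_nonneg (hgt _) (hdN p))
      (hi2.const_mul m) (.of_forall fun p => ?_)
    exact (div_le_div_of_nonneg_right (hgG _) (hdN p)).trans_eq (mul_div_assoc _ _ _)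
  have hA0 : 0 ≤ ∫ p : Euc N × Euc N, g ((u p.1 - u p.2) / dist p.1 p.2 ^ α) *
      ((u p.1 - u p.2) / dist p.1 p.2 ^ α) / dist p.1 p.2 ^ (N : ℝ) :=
    integral_nonneg fun p => div_nonneg (hgt _) (hdN p)
  have hBi : Integrable fun x => g (u x) * u x := by
    refine (hi1.const_mul m).mono' ((hg.measurable.comp hum).mul hum).aestronglyMeasurable
      (.of_forall fun x => ?_)
    rw [Real.norm_of_nonneg (hgt _)]
    exact hgG _
  -- the reaction term is integrable: otherwise its integral is `0` and `u` vanishes a.e.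
  have hfi : Integrable fun x => K x * f (u x) * u x := by
    by_contra hni
    rw [integral_undef hni] at hJ
    have hB0 : 0 ≤ ∫ x, g (u x) * u x := integral_nonneg fun x => hgt _
    have hz := (integral_eq_zero_iff_of_nonneg (fun x => hgt _) hBi).1 (by linarith)
    refine hne (hz.mono fun x hx => ?_)
    by_contra hx0
    rcases mul_eq_zero.1 hx with h | h
    · rcases lt_or_gt_of_ne hx0 with h' | h'
      · have := hpos (-u x) (by linarith)
        rw [hodd, h] at this
        simp at this
      · exact (hpos _ h').ne' h
    · exact hx0 h
  have hF0 : ∀ t, 0 ≤ F t ∧ F t ≤ θ⁻¹ * (f t * t) := fun t => by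
    rcases eq_or_ne t 0 with rfl | ht
    · simp [primitive_zero hF]
    · obtain ⟨h1, h2⟩ := hf3 t ht
      refine ⟨(pos_of_mul_pos_right h1 hθ.le).le, ?_⟩
      rw [le_inv_mul_iff₀ hθ]
      linarith
  have hFi : ∫ x, K x * F (u x) ≤ θ⁻¹ * ∫ x, K x * f (u x) * u x := by
    rw [← integral_const_mul]
    refine integral_mono_of_nonneg (.of_forall fun x => mul_nonneg (hK x).le (hF0 _).1)
      (hfi.const_mul _) (.of_forall fun x => ?_)
    calc K x * F (u x) ≤ K x * (θ⁻¹ * (f (u x) * u x)) :=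
          mul_le_mul_of_nonneg_left (hF0 _).2 (hK x).le
      _ = θ⁻¹ * (K x * f (u x) * u x) := by ring
  have hle : ∫ x, K x * f (u x) * u x ≤ m * rhoT α G u := by
    rw [rhoT]
    linarith
  have := mul_le_mul_of_nonneg_left hle (inv_pos.2 hθ).le
  rw [Jfun, div_eq_inv_mul]
  linarith

end Nehari

theorem stmt_13
    (N : ℕ) (hN : 3 ≤ N)
    (α : ℝ) (hα : 0 < α ∧ α < 1)
    (g : ℝ → ℝ)
    (hg_odd : ∀ t, g (-t) = - g t)
    (hg_mono : Monotone g)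
    (hg_smooth : ContDiff ℝ 1 g)
    (hg_zero : g 0 = 0)
    (hg_pos : ∀ t > (0:ℝ), 0 < g t)
    (hg_top : Tendsto g atTop atTop)
    (G : ℝ → ℝ)
    (hG : ∀ t, G t = ∫ s in (0:ℝ)..t, g s)
    (L m : ℝ)
    (hL : (N:ℝ)/2 < L ∧ L < (N:ℝ))
    (hm : L < m ∧ m < min (L * (N:ℝ) / ((N:ℝ) - L) / 2) (N:ℝ))
    (hg2 : ∀ t > (0:ℝ), L ≤ t * g t / G t ∧ t * g t / G t ≤ m)
    (hg3 : ∀ t > (0:ℝ), L - 1 ≤ t * deriv g t / g t ∧ t * deriv g t / g t ≤ m - 1)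
    (f F : ℝ → ℝ)
    (hf_smooth : ContDiff ℝ 1 f)
    (hF : ∀ t, F t = ∫ s in (0:ℝ)..t, f s)
    (θ : ℝ)
    (hθ : 2 * m < θ ∧ θ < L * (N:ℝ) / ((N:ℝ) - L))
    (hf3 : ∀ t : ℝ, t ≠ 0 → 0 < θ * F t ∧ θ * F t ≤ t * f t)
    (K : Euc N → ℝ)
    (hK_cont : Continuous K)
    (hK_pos : ∀ x, 0 < K x)
    (hK_bdd : BddAbove (Set.range K))
    :
    (∀ u ∈ Nehari α G g f K,
        (1 - m/θ) * min (wNorm α G u ^ L) (wNorm α G u ^ m) ≤ Jfun α G F K u) ∧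
      (∀ C : ℝ, ∃ D : ℝ, ∀ u ∈ Nehari α G g f K, D ≤ wNorm α G u → C ≤ Jfun α G F K u) := by
  have hN' : (3:ℝ) ≤ N := by exact_mod_cast hN
  have hL1 : 1 ≤ L := by linarith [hL.1]
  have hm1 : 1 ≤ m := by linarith [hm.1]
  have hθ0 : 0 < θ := by linarith [hθ.1]
  have hc : 0 < 1 - m / θ := by
    rw [sub_pos, div_lt_one hθ0]
    linarith [hθ.1]
  have hg := hg_smooth.continuous
  have main : ∀ u ∈ Nehari α G g f K,
      (1 - m/θ) * min (wNorm α G u ^ L) (wNorm α G u ^ m) ≤ Jfun α G F K u := fun u hu =>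
    (mul_le_mul_of_nonneg_left (min_rpow_wNorm_le_rhoT hg hg_odd hg_pos hG hg2
      (by linarith) (by linarith) hu.1) hc.le).trans
      (mul_rhoT_le_Jfun hα.1 hg hg_odd hg_pos hG (fun t ht => (hg2 t ht).2)
        hF hθ0 hf3 hK_pos hu)
  refine ⟨main, fun C => ⟨max 1 (C / (1 - m/θ)), fun u hu hD => ?_⟩⟩
  have h1 : 1 ≤ wNorm α G u := (le_max_left _ _).trans hD
  have h2 : C ≤ wNorm α G u * (1 - m/θ) := (div_le_iff₀ hc).1 ((le_max_right _ _).trans hD)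
  have h3 : wNorm α G u ≤ min (wNorm α G u ^ L) (wNorm α G u ^ m) :=
    le_min (Real.self_le_rpow_of_one_le h1 hL1) (Real.self_le_rpow_of_one_le h1 hm1)
  refine le_trans ?_ (main u hu)
  rw [mul_comm] at h2
  exact h2.trans (mul_le_mul_of_nonneg_left h3 hc.le)
end
end
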